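/- Let n ≥ 2 and b > −1 be a constant. Let ψ* be a real-valued function on the closed half-space ℝⁿ₊ ∪ {y_n = 0} that is C¹ there with globally Lipschitz gradient, C² in the open half-space ℝⁿ₊, and satisfies ∂²ψ*/∂y_n² + b·(∂ψ*/∂y_n)/y_n + det D²_{y'}ψ* = 0 in ℝⁿ₊. Assume ∂ψ*/∂y_n(y',0) = 0 for all y' ∈ ℝ^{n-1}, that the (n−1)×(n−1) matrix D²_{y'}ψ*(y) is positive definite for every y ∈ ℝⁿ₊, and that there are constants K₁, K₂ with ‖D²ψ*(y)‖ ≤ K₁ and ‖(D²_{y'}ψ*(y))⁻¹‖ ≤ K₂ for all y ∈ ℝⁿ₊. Then there exist α ∈ (0,1) and C > 0, depending only on b, n, K₁, K₂, such that |(∂ψ*/∂y_n)(y)/y_n − (∂ψ*/∂y_n)(z)/z_n| ≤ C|y − z|^α for all y, z ∈ ℝ^{n-1} × (0,1]. -/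

import Mathlib

open MeasureTheory
open scoped ENNReal

noncomputable section

/-- Euclidean n-space. -/
abbrev Eu (n : ℕ) := EuclideanSpace ℝ (Fin n)

/-- Partial derivative ∂ψ/∂xᵢ. -/
def pd {n : ℕ} (ψ : Eu n → ℝ) (i : Fin n) (x : Eu n) : ℝ :=
  fderiv ℝ ψ x (EuclideanSpace.single i 1)

/-- Second partial derivative ∂²ψ/∂xᵢ∂xⱼ. -/
def pd2 {n : ℕ} (ψ : Eu n → ℝ) (i j : Fin n) (x : Eu n) : ℝ :=
  pd (pd ψ j) i x


section LinearAlgebra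

variable {ι : Type*} [Fintype ι] [DecidableEq ι]

open Matrix in
lemma Matrix.PosSemidef.det_le_exp_trace_sub_card {M : Matrix ι ι ℝ} (hM : M.PosSemidef) :
    M.det ≤ Real.exp (M.trace - Fintype.card ι) := by
  have h : M.trace - Fintype.card ι = ∑ i, (hM.1.eigenvalues i - 1) := by
    rw [hM.1.trace_eq_sum_eigenvalues]
    simp
  rw [h, Real.exp_sum, hM.1.det_eq_prod_eigenvalues]
  refine Finset.prod_le_prod (fun i _ => by simpa using hM.eigenvalues_nonneg i) fun i _ => ?_
  have := Real.add_one_le_exp (hM.1.eigenvalues i - 1)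
  simpa using this

open Matrix in
lemma Matrix.IsHermitian.eigenvectorBasis_dotProduct_self {P : Matrix ι ι ℝ}
    (hP : P.IsHermitian) (k : ι) :
    (hP.eigenvectorBasis k).ofLp ⬝ᵥ (hP.eigenvectorBasis k).ofLp = 1 := by
  have h := hP.eigenvectorBasis.orthonormal.1 k
  have h2 : inner ℝ (hP.eigenvectorBasis k) (hP.eigenvectorBasis k) = (1 : ℝ) := by
    rw [real_inner_self_eq_norm_sq, h]; norm_num
  rw [EuclideanSpace.inner_eq_star_dotProduct] at h2
  simpa using h2

open Matrix in
lemma Matrix.IsHermitian.eigenvectorBasis_dotProduct_mulVec {P : Matrix ι ι ℝ}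
    (hP : P.IsHermitian) (k : ι) :
    (hP.eigenvectorBasis k).ofLp ⬝ᵥ P *ᵥ (hP.eigenvectorBasis k).ofLp = hP.eigenvalues k := by
  rw [hP.mulVec_eigenvectorBasis, dotProduct_smul, hP.eigenvectorBasis_dotProduct_self]
  simp

open Matrix in
lemma Matrix.IsHermitian.sum_eigenvectorBasis_dotProduct_sq {P : Matrix ι ι ℝ}
    (hP : P.IsHermitian) (x : ι → ℝ) :
    ∑ k, (x ⬝ᵥ (hP.eigenvectorBasis k).ofLp) ^ 2 = x ⬝ᵥ x := by
  have h := hP.eigenvectorBasis.sum_sq_inner_right (WithLp.toLp 2 x)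
  simp only [EuclideanSpace.inner_eq_star_dotProduct] at h
  rw [EuclideanSpace.norm_sq_eq] at h
  simpa [dotProduct, sq] using h

open Matrix in
lemma Matrix.IsHermitian.eigenvalues_mem_Icc {P : Matrix ι ι ℝ} (hP : P.IsHermitian) {lo hi : ℝ}
    (hlo : ∀ ξ : ι → ℝ, lo * (ξ ⬝ᵥ ξ) ≤ ξ ⬝ᵥ P *ᵥ ξ)
    (hhi : ∀ ξ : ι → ℝ, ξ ⬝ᵥ P *ᵥ ξ ≤ hi * (ξ ⬝ᵥ ξ)) (k : ι) :
    hP.eigenvalues k ∈ Set.Icc lo hi := by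
  have h1 := hlo (hP.eigenvectorBasis k).ofLp
  have h2 := hhi (hP.eigenvectorBasis k).ofLp
  rw [hP.eigenvectorBasis_dotProduct_self, hP.eigenvectorBasis_dotProduct_mulVec, mul_one] at h1 h2
  exact ⟨h1, h2⟩

open Matrix in
lemma Matrix.IsHermitian.det_mem_Icc {P : Matrix ι ι ℝ} (hP : P.IsHermitian) {lo hi : ℝ}
    (h0 : 0 ≤ lo)
    (hlo : ∀ ξ : ι → ℝ, lo * (ξ ⬝ᵥ ξ) ≤ ξ ⬝ᵥ P *ᵥ ξ)
    (hhi : ∀ ξ : ι → ℝ, ξ ⬝ᵥ P *ᵥ ξ ≤ hi * (ξ ⬝ᵥ ξ)) :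
    P.det ∈ Set.Icc (lo ^ Fintype.card ι) (hi ^ Fintype.card ι) := by
  have h := hP.eigenvalues_mem_Icc hlo hhi
  rw [hP.det_eq_prod_eigenvalues]
  constructor
  · calc lo ^ Fintype.card ι = ∏ _i : ι, lo := by simp
      _ ≤ _ := Finset.prod_le_prod (fun _ _ => h0) fun i _ => by simpa using (h i).1
  · calc _ ≤ ∏ _i : ι, hi :=
          Finset.prod_le_prod (fun i _ => by simpa using h0.trans (h i).1)
            fun i _ => by simpa using (h i).2
      _ = hi ^ Fintype.card ι := by simp

open Matrix in
/-- Concavity of `log det`, in the form needed to compare two Hessians. -/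
lemma Matrix.PosDef.det_le_det_mul_exp {P Q : Matrix ι ι ℝ} (hP : P.PosDef) (hQ : Q.PosSemidef)
    {K₁ K₂ α c : ℝ} (hK₂ : 0 < K₂) (hα : 0 ≤ α) (hc : 0 ≤ c)
    (hlo : ∀ ξ : ι → ℝ, K₂⁻¹ * (ξ ⬝ᵥ ξ) ≤ ξ ⬝ᵥ P *ᵥ ξ)
    (hhi : ∀ ξ : ι → ℝ, ξ ⬝ᵥ P *ᵥ ξ ≤ K₁ * (ξ ⬝ᵥ ξ)) (x : ι → ℝ)
    (hPQ : ∀ ξ : ι → ℝ, ξ ⬝ᵥ Q *ᵥ ξ ≤ ξ ⬝ᵥ P *ᵥ ξ - α * (x ⬝ᵥ ξ) ^ 2 + c * (ξ ⬝ᵥ ξ)) :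
    Q.det ≤ P.det * Real.exp (-(α * (x ⬝ᵥ x) / K₁ - c * Fintype.card ι * K₂)) := by
  have hpos := fun k => hP.eigenvalues_pos k
  have hmem := hP.1.eigenvalues_mem_Icc hlo hhi
  set lam := hP.1.eigenvalues with hlam
  set v : ι → ι → ℝ := fun k => (hP.1.eigenvectorBasis k).ofLp with hv
  set V : Matrix ι ι ℝ := hP.1.eigenvectorUnitary.1 with hV
  set S : Matrix ι ι ℝ := V * diagonal (fun k => (√(lam k))⁻¹) with hS
  have hScol : ∀ k, S.col k = (√(lam k))⁻¹ • v k := by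
    intro k
    ext i
    simp [hS, hV, hv, Matrix.mul_diagonal, mul_comm, Matrix.IsHermitian.eigenvectorUnitary_apply]
  have hdetV : V.det ^ 2 = 1 := by
    have h1 : star V * V = 1 := (Matrix.mem_unitaryGroup_iff').1 hP.1.eigenvectorUnitary.2
    have h2 := congrArg Matrix.det h1
    rw [det_mul, det_one, star_eq_conjTranspose, det_conjTranspose] at h2
    simpa [sq] using h2
  have hdetS : P.det * S.det ^ 2 = 1 := by
    have hd : P.det = ∏ k, lam k := by simpa using hP.1.det_eq_prod_eigenvalues
    rw [hS, det_mul, mul_pow, hdetV, det_diagonal, hd, ← Finset.prod_pow, one_mul,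
      ← Finset.prod_mul_distrib]
    refine Finset.prod_eq_one fun k _ => ?_
    rw [inv_pow, Real.sq_sqrt (hpos k).le, mul_inv_cancel₀ (hpos k).ne']
  have hM := hQ.conjTranspose_mul_mul_same S
  have hdetM : (Sᴴ * Q * S).det = Q.det * S.det ^ 2 := by
    rw [det_mul, det_mul, det_conjTranspose]
    simp
    ring
  have htr : (Sᴴ * Q * S).trace = ∑ k, (lam k)⁻¹ * (v k ⬝ᵥ Q *ᵥ v k) := by
    refine Finset.sum_congr rfl fun k _ => ?_
    have : (Sᴴ * Q * S).diag k = S.col k ⬝ᵥ Q *ᵥ S.col k := by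
      rw [dotProduct_mulVec]
      rfl
    rw [this, hScol, mulVec_smul, smul_dotProduct, dotProduct_smul, smul_eq_mul, smul_eq_mul,
      ← mul_assoc, ← mul_inv, Real.mul_self_sqrt (hpos k).le]
  have hbound : (Sᴴ * Q * S).trace - Fintype.card ι
      ≤ -(α * (x ⬝ᵥ x) / K₁ - c * Fintype.card ι * K₂) := by
    have hterm : ∀ k, (lam k)⁻¹ * (v k ⬝ᵥ Q *ᵥ v k)
        ≤ 1 - α / K₁ * (x ⬝ᵥ v k) ^ 2 + c * K₂ := by
      intro k
      have h1 := hPQ (v k)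
      rw [hP.1.eigenvectorBasis_dotProduct_self, hP.1.eigenvectorBasis_dotProduct_mulVec] at h1
      have h2 : (lam k)⁻¹ ≤ K₂ := inv_le_of_inv_le₀ hK₂ (hmem k).1
      have h3 : K₁⁻¹ ≤ (lam k)⁻¹ := inv_anti₀ (hpos k) (hmem k).2
      calc (lam k)⁻¹ * (v k ⬝ᵥ Q *ᵥ v k)
          ≤ (lam k)⁻¹ * (lam k - α * (x ⬝ᵥ v k) ^ 2 + c * 1) :=
            mul_le_mul_of_nonneg_left h1 (inv_pos.2 (hpos k)).le
        _ = 1 - α * (x ⬝ᵥ v k) ^ 2 * (lam k)⁻¹ + c * (lam k)⁻¹ := by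
            have := (hpos k).ne'
            field_simp
        _ ≤ 1 - α * (x ⬝ᵥ v k) ^ 2 * K₁⁻¹ + c * K₂ := by gcongr
        _ = _ := by ring
    rw [htr]
    calc _ ≤ ∑ k, (1 - α / K₁ * (x ⬝ᵥ v k) ^ 2 + c * K₂) - (Fintype.card ι : ℝ) :=
          sub_le_sub_right (Finset.sum_le_sum fun k _ => hterm k) _
      _ = _ := by
          rw [Finset.sum_add_distrib, Finset.sum_sub_distrib, ← Finset.mul_sum,
            hP.1.sum_eigenvectorBasis_dotProduct_sq]
          simp
          ring
  have hfin := hM.det_le_exp_trace_sub_card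
  rw [hdetM] at hfin
  have hPd := hP.det_pos
  calc Q.det = P.det * (Q.det * S.det ^ 2) := by linear_combination -Q.det * hdetS
    _ ≤ _ := mul_le_mul_of_nonneg_left (hfin.trans (Real.exp_le_exp.2 hbound)) hPd.le

end LinearAlgebra
section Calculus

lemma second_deriv_nonneg_of_isLocalMin {F F' : ℝ → ℝ} {x₀ F'' : ℝ}
    (hF : ∀ᶠ x in nhds x₀, HasDerivAt F (F' x) x) (hF' : HasDerivAt F' F'' x₀)
    (hmin : IsLocalMin F x₀) : 0 ≤ F'' := by
  by_contra! hneg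
  have hd : deriv F =ᶠ[nhds x₀] F' := hF.mono fun x hx => hx.deriv
  have hdd : deriv (deriv F) x₀ = F'' := by rw [hd.deriv_eq, hF'.deriv]
  have hmax : IsLocalMax F x₀ :=
    isLocalMax_of_deriv_deriv_neg (by rwa [hdd]) hmin.deriv_eq_zero hF.self_of_nhds.continuousAt
  have hconst : F =ᶠ[nhds x₀] fun _ => F x₀ := by
    filter_upwards [hmin, hmax] with x h1 h2 using le_antisymm h2 h1
  have hd0 : deriv F =ᶠ[nhds x₀] fun _ => (0 : ℝ) := by
    filter_upwards [hconst.eventuallyEq_nhds] with x hx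
    rw [hx.deriv_eq, deriv_const]
  rw [hd0.deriv_eq, deriv_const] at hdd
  linarith

end Calculus

section HalfSpace

variable {n : ℕ} {ψ : Eu n → ℝ} {ln : Fin n}

/-- The quotient `ψ_{y_n} / y_n`. -/
def normalSlope (ψ : Eu n → ℝ) (ln : Fin n) (y : Eu n) : ℝ := pd ψ ln y / y ln

/-- The derivative of `normalSlope ψ ln` with respect to `s = y_n ^ 2 / 2`. -/
def normalSlopeDeriv (ψ : Eu n → ℝ) (ln : Fin n) (y : Eu n) : ℝ :=
  (pd2 ψ ln ln y - pd ψ ln y / y ln) / y ln ^ 2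

/-- The point with the same tangential coordinates as `y` and with `y_n ^ 2 / 2 = s`. -/
def normalLift (ln : Fin n) (y : Eu n) (s : ℝ) : Eu n :=
  y + (√(2 * s) - y ln) • EuclideanSpace.single ln (1 : ℝ)

@[simp] lemma normalLift_apply_self (y : Eu n) (s : ℝ) : normalLift ln y s ln = √(2 * s) := by
  simp [normalLift]

lemma normalLift_self {y : Eu n} (hy : 0 < y ln) : normalLift ln y (y ln ^ 2 / 2) = y := by
  have : √(2 * (y ln ^ 2 / 2)) = y ln := by
    rw [mul_div_cancel₀ _ two_ne_zero, Real.sqrt_sq hy.le]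
  simp [normalLift, this]

lemma normalLift_add {v : Eu n} (hv : v ln = 0) (y : Eu n) (s : ℝ) :
    normalLift ln (y + v) s = normalLift ln y s + v := by
  simp [normalLift, hv]
  abel

lemma normalLift_lift (y : Eu n) (s t : ℝ) :
    normalLift ln (normalLift ln y s) t = normalLift ln y t := by
  simp only [normalLift, PiLp.add_apply, PiLp.smul_apply, PiLp.single_apply, if_true,
    smul_eq_mul, mul_one]
  rw [add_assoc, ← add_smul]
  congr 2
  ring

lemma sq_normalLift_apply {s : ℝ} (hs : 0 ≤ s) (y : Eu n) : normalLift ln y s ln ^ 2 / 2 = s := by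
  rw [normalLift_apply_self, Real.sq_sqrt (by positivity)]
  ring

lemma normalLift_pos {s : ℝ} (hs : 0 < s) (y : Eu n) : 0 < normalLift ln y s ln := by
  rw [normalLift_apply_self]
  positivity

lemma hasDerivAt_sqrt_two_mul {s : ℝ} (hs : 0 < s) :
    HasDerivAt (fun s => √(2 * s)) (√(2 * s))⁻¹ s := by
  have h := ((hasDerivAt_id s).const_mul 2).sqrt (by simpa using hs.ne')
  refine h.congr_deriv ?_
  simp only [id_eq]
  field_simp

lemma hasDerivAt_normalLift {s : ℝ} (hs : 0 < s) (y : Eu n) :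
    HasDerivAt (normalLift ln y) ((√(2 * s))⁻¹ • EuclideanSpace.single ln (1 : ℝ)) s :=
  (((hasDerivAt_sqrt_two_mul hs).sub_const _).smul_const _).const_add y

lemma isOpen_halfSpace (ln : Fin n) : IsOpen {y : Eu n | 0 < y ln} :=
  isOpen_lt continuous_const (by fun_prop)

lemma hasFDerivAt_of_contDiffOn (hψ : ContDiffOn ℝ 2 ψ {y : Eu n | 0 < y ln}) {y : Eu n}
    (hy : 0 < y ln) : HasFDerivAt ψ (fderiv ℝ ψ y) y :=
  ((hψ.contDiffAt ((isOpen_halfSpace ln).mem_nhds hy)).differentiableAt (by norm_num)).hasFDerivAt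

lemma contDiffAt_fderiv (hψ : ContDiffOn ℝ 2 ψ {y : Eu n | 0 < y ln}) {y : Eu n}
    (hy : 0 < y ln) : ContDiffAt ℝ 1 (fderiv ℝ ψ) y :=
  (hψ.contDiffAt ((isOpen_halfSpace ln).mem_nhds hy)).fderiv_right (by norm_num)

lemma hasFDerivAt_fderiv (hψ : ContDiffOn ℝ 2 ψ {y : Eu n | 0 < y ln}) {y : Eu n}
    (hy : 0 < y ln) : HasFDerivAt (fderiv ℝ ψ) (fderiv ℝ (fderiv ℝ ψ) y) y :=
  ((contDiffAt_fderiv hψ hy).differentiableAt (by norm_num)).hasFDerivAt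

lemma pd2_eq (hψ : ContDiffOn ℝ 2 ψ {y : Eu n | 0 < y ln}) {y : Eu n} (hy : 0 < y ln)
    (i j : Fin n) : pd2 ψ i j y =
      fderiv ℝ (fderiv ℝ ψ) y (EuclideanSpace.single i 1) (EuclideanSpace.single j 1) := by
  have h := (hasFDerivAt_fderiv hψ hy).clm_apply
    (hasFDerivAt_const (EuclideanSpace.single j (1 : ℝ)) y)
  have h2 : HasFDerivAt (pd ψ j) _ y := h
  rw [pd2, pd, h2.fderiv]
  simp

lemma continuousAt_pd (hψ : ContDiffOn ℝ 2 ψ {y : Eu n | 0 < y ln}) {y : Eu n} (hy : 0 < y ln)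
    (i : Fin n) : ContinuousAt (pd ψ i) y :=
  (contDiffAt_fderiv hψ hy).continuousAt.clm_apply continuousAt_const

lemma continuousAt_pd2 (hψ : ContDiffOn ℝ 2 ψ {y : Eu n | 0 < y ln}) {y : Eu n} (hy : 0 < y ln)
    (i j : Fin n) : ContinuousAt (pd2 ψ i j) y := by
  have h : pd2 ψ i j =ᶠ[nhds y] fun y =>
      fderiv ℝ (fderiv ℝ ψ) y (EuclideanSpace.single i 1) (EuclideanSpace.single j 1) := by
    filter_upwards [(isOpen_halfSpace ln).mem_nhds hy] with z hz using pd2_eq hψ hz i j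
  refine ContinuousAt.congr ?_ h.symm
  have h2 : ContinuousAt (fderiv ℝ (fderiv ℝ ψ)) y :=
    ((contDiffAt_fderiv hψ hy).fderiv_right (m := 0) (by norm_num)).continuousAt
  exact (h2.clm_apply continuousAt_const).clm_apply continuousAt_const

lemma continuousAt_normalSlope (hψ : ContDiffOn ℝ 2 ψ {y : Eu n | 0 < y ln}) {y : Eu n}
    (hy : 0 < y ln) : ContinuousAt (normalSlope ψ ln) y :=
  (continuousAt_pd hψ hy ln).div (Continuous.continuousAt (by fun_prop)) hy.ne'

lemma continuousAt_normalSlopeDeriv (hψ : ContDiffOn ℝ 2 ψ {y : Eu n | 0 < y ln}) {y : Eu n}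
    (hy : 0 < y ln) : ContinuousAt (normalSlopeDeriv ψ ln) y :=
  ((continuousAt_pd2 hψ hy ln ln).sub (continuousAt_normalSlope hψ hy)).div
    (Continuous.continuousAt (by fun_prop))
    (pow_ne_zero _ hy.ne')

lemma hasDerivAt_comp_lift (hψ : ContDiffOn ℝ 2 ψ {y : Eu n | 0 < y ln}) {s : ℝ} (hs : 0 < s)
    (y : Eu n) :
    HasDerivAt (fun s => ψ (normalLift ln y s)) (normalSlope ψ ln (normalLift ln y s)) s := by
  have h := (hasFDerivAt_of_contDiffOn hψ (normalLift_pos hs y)).comp_hasDerivAt s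
    (hasDerivAt_normalLift hs y)
  refine h.congr_deriv ?_
  simp [normalSlope, pd, div_eq_inv_mul]

lemma hasDerivAt_normalSlope_lift (hψ : ContDiffOn ℝ 2 ψ {y : Eu n | 0 < y ln}) {s : ℝ}
    (hs : 0 < s) (y : Eu n) :
    HasDerivAt (fun s => normalSlope ψ ln (normalLift ln y s))
      (normalSlopeDeriv ψ ln (normalLift ln y s)) s := by
  have hpos := normalLift_pos (ln := ln) hs y
  have h1 := (hasFDerivAt_fderiv hψ hpos).clm_apply
    (hasFDerivAt_const (EuclideanSpace.single ln (1 : ℝ)) (normalLift ln y s))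
  have h2 : HasFDerivAt (pd ψ ln) _ (normalLift ln y s) := h1
  have h3 := (h2.comp_hasDerivAt s (hasDerivAt_normalLift hs y)).div (hasDerivAt_sqrt_two_mul hs)
    (by positivity)
  have h4 : (fun s => normalSlope ψ ln (normalLift ln y s))
      = fun s => (pd ψ ln ∘ normalLift ln y) s / √(2 * s) := by
    ext s
    rw [normalSlope, normalLift_apply_self, Function.comp_apply]
  rw [h4]
  refine h3.congr_deriv ?_
  have ht : 0 < √(2 * s) := by positivity
  simp only [normalSlopeDeriv, normalLift_apply_self, pd2_eq hψ hpos]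
  simp
  field_simp

/-- The restriction of the Hessian to a line. -/
lemma hasDerivAt_comp_line (hψ : ContDiffOn ℝ 2 ψ {y : Eu n | 0 < y ln}) {z : Eu n}
    (hz : 0 < z ln) (v : Eu n) (t : ℝ) (hv : v ln = 0) :
    HasDerivAt (fun t : ℝ => ψ (z + t • v)) (fderiv ℝ ψ (z + t • v) v) t := by
  have hl : HasDerivAt (fun t : ℝ => z + t • v) v t := by
    simpa using ((hasDerivAt_id t).smul_const v).const_add z
  exact (hasFDerivAt_of_contDiffOn hψ (y := z + t • v) (by simpa [hv] using hz)).comp_hasDerivAt t hl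

lemma hasDerivAt_fderiv_line (hψ : ContDiffOn ℝ 2 ψ {y : Eu n | 0 < y ln}) {z : Eu n}
    (hz : 0 < z ln) (v : Eu n) :
    HasDerivAt (fun t : ℝ => fderiv ℝ ψ (z + t • v) v) (fderiv ℝ (fderiv ℝ ψ) z v v) 0 := by
  have hl : HasDerivAt (fun t : ℝ => z + t • v) v 0 := by
    simpa using ((hasDerivAt_id (0 : ℝ)).smul_const v).const_add z
  have h0 : z + (0 : ℝ) • v = z := by simp
  have h1 : HasFDerivAt (fderiv ℝ ψ) (fderiv ℝ (fderiv ℝ ψ) z) (z + (0 : ℝ) • v) := by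
    rw [h0]
    exact hasFDerivAt_fderiv hψ hz
  have h2 : HasDerivAt (fun t : ℝ => fderiv ℝ ψ (z + t • v)) (fderiv ℝ (fderiv ℝ ψ) z v) 0 :=
    h1.comp_hasDerivAt 0 hl
  have h3 := h2.clm_apply (hasDerivAt_const (0 : ℝ) v)
  rw [map_zero, add_zero] at h3
  exact h3

/-- Moving slightly in the normal direction changes a continuous function uniformly little on a
compact set. -/
lemma exists_lift_close {F : Eu n → ℝ} {K : Set (Eu n)} (hK : IsCompact K) {ε₀ : ℝ} (hε₀ : 0 < ε₀)
    (hKε : ∀ y ∈ K, ε₀ ≤ y ln) (hF : ∀ y : Eu n, 0 < y ln → ContinuousAt F y) {η : ℝ}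
    (hη : 0 < η) :
    ∃ τ₀ > 0, ∀ y ∈ K, ∀ s : ℝ, |s - y ln ^ 2 / 2| < τ₀ → |F (normalLift ln y s) - F y| < η := by
  have h := hK.uniformContinuousAt_of_continuousAt F
    (fun y hy => hF y (hε₀.trans_le (hKε y hy))) (Metric.dist_mem_uniformity hη)
  obtain ⟨δ, hδ, hd⟩ := Metric.mem_uniformity_dist.1 h
  refine ⟨δ * ε₀ / 2, by positivity, fun y hy s hs => ?_⟩
  have hy0 := hKε y hy
  have hlt : dist y (normalLift ln y s) < δ := by
    rw [dist_eq_norm, normalLift, sub_add_cancel_left, norm_neg, norm_smul]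
    simp only [PiLp.norm_single, norm_one, mul_one, Real.norm_eq_abs]
    have hk : |√(2 * s) - y ln| * ε₀ ≤ 2 * |s - y ln ^ 2 / 2| := by
      rcases le_or_gt 0 s with h0 | h0
      · have hsq : √(2 * s) ^ 2 = 2 * s := Real.sq_sqrt (by positivity)
        have hnn := Real.sqrt_nonneg (2 * s)
        calc |√(2 * s) - y ln| * ε₀ ≤ |√(2 * s) - y ln| * |√(2 * s) + y ln| := by
              gcongr
              rw [abs_of_nonneg (by linarith)]
              linarith
          _ = |2 * (s - y ln ^ 2 / 2)| := by
              rw [← abs_mul]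
              congr 1
              linear_combination hsq
          _ = _ := by rw [abs_mul, abs_two]
      · rw [Real.sqrt_eq_zero_of_nonpos (by linarith), zero_sub, abs_neg,
          abs_of_pos (by linarith), abs_of_neg (by nlinarith)]
        nlinarith
    nlinarith
  have h2 := hd hlt hy
  rw [Set.mem_ofPred_eq, dist_comm, Real.dist_eq] at h2
  exact h2

end HalfSpace
section Touching

variable {n : ℕ} {ψ : Eu n → ℝ} {ln : Fin n}

/-- A tangential vector, seen as a vector of the whole space. -/
def extendTangential (ξ : {k : Fin n // k ≠ ln} → ℝ) : Eu n :=
  ∑ i, ξ i • EuclideanSpace.single i.1 (1 : ℝ)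

@[simp] lemma extendTangential_apply_normal (ξ : {k : Fin n // k ≠ ln} → ℝ) :
    extendTangential ξ ln = 0 := by
  simp only [extendTangential, WithLp.ofLp_sum, Finset.sum_apply]
  refine Finset.sum_eq_zero fun i _ => ?_
  simp [i.2.symm]

@[simp] lemma extendTangential_apply (ξ : {k : Fin n // k ≠ ln} → ℝ) (i : {k : Fin n // k ≠ ln}) :
    extendTangential ξ i.1 = ξ i := by
  simp only [extendTangential, WithLp.ofLp_sum, Finset.sum_apply]
  rw [Finset.sum_eq_single i]
  · simp
  · intro j _ hj
    have : i.1 ≠ j.1 := fun h => hj (Subtype.ext h.symm)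
    simp [this]
  · simp

open Matrix

lemma inner_extendTangential (x : Eu n) (ξ : {k : Fin n // k ≠ ln} → ℝ) :
    inner ℝ x (extendTangential ξ) = (fun i : {k : Fin n // k ≠ ln} => x i.1) ⬝ᵥ ξ := by
  rw [extendTangential, inner_sum, dotProduct]
  refine Finset.sum_congr rfl fun i _ => ?_
  rw [inner_smul_right, EuclideanSpace.inner_single_right]
  simp [mul_comm]

lemma norm_sq_extendTangential (ξ : {k : Fin n // k ≠ ln} → ℝ) :
    ‖extendTangential ξ‖ ^ 2 = ξ ⬝ᵥ ξ := by
  rw [← real_inner_self_eq_norm_sq, inner_extendTangential]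
  simp

/-- The tangential block of the Hessian of `ψ`. -/
def tangentialHessian (ψ : Eu n → ℝ) (ln : Fin n) (y : Eu n) :
    Matrix {k : Fin n // k ≠ ln} {k : Fin n // k ≠ ln} ℝ :=
  Matrix.of fun i j => pd2 ψ i.1 j.1 y

lemma dotProduct_tangentialHessian (hψ : ContDiffOn ℝ 2 ψ {y : Eu n | 0 < y ln}) {y : Eu n}
    (hy : 0 < y ln) (ξ : {k : Fin n // k ≠ ln} → ℝ) :
    ξ ⬝ᵥ tangentialHessian ψ ln y *ᵥ ξ =
      fderiv ℝ (fderiv ℝ ψ) y (extendTangential ξ) (extendTangential ξ) := by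
  simp only [extendTangential, map_sum, map_smul, _root_.sum_apply,
    _root_.smul_apply, dotProduct, mulVec, tangentialHessian, of_apply,
    pd2_eq hψ hy, smul_eq_mul, Finset.mul_sum]
  rw [Finset.sum_comm]
  refine Finset.sum_congr rfl fun i _ => Finset.sum_congr rfl fun j _ => ?_
  ring

/-- `C²` solutions of the equation on the open half-space with uniformly bounded tangential
Hessian. -/
structure IsHalfSpaceSolution (ψ : Eu n → ℝ) (ln : Fin n) (b K₁ K₂ : ℝ) : Prop where
  contDiffOn : ContDiffOn ℝ 2 ψ {y : Eu n | 0 < y ln}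
  equation : ∀ y : Eu n, 0 < y ln →
    pd2 ψ ln ln y + b * pd ψ ln y / y ln + (tangentialHessian ψ ln y).det = 0
  posDef : ∀ y : Eu n, 0 < y ln → (tangentialHessian ψ ln y).PosDef
  le_upper : ∀ y : Eu n, 0 < y ln → ∀ ξ : {k : Fin n // k ≠ ln} → ℝ,
    ξ ⬝ᵥ tangentialHessian ψ ln y *ᵥ ξ ≤ K₁ * (ξ ⬝ᵥ ξ)
  lower_le : ∀ y : Eu n, 0 < y ln → ∀ ξ : {k : Fin n // k ≠ ln} → ℝ,
    K₂⁻¹ * (ξ ⬝ᵥ ξ) ≤ ξ ⬝ᵥ tangentialHessian ψ ln y *ᵥ ξ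

lemma IsHalfSpaceSolution.equation_lift {b K₁ K₂ : ℝ} (h : IsHalfSpaceSolution ψ ln b K₁ K₂)
    {y : Eu n} (hy : 0 < y ln) :
    2 * (y ln ^ 2 / 2) * normalSlopeDeriv ψ ln y + (1 + b) * normalSlope ψ ln y
      = -(tangentialHessian ψ ln y).det := by
  have := h.equation y hy
  rw [normalSlopeDeriv, normalSlope]
  field_simp at this ⊢
  linarith

/-- The comparison function: a Gaussian bump centred at height `R`, corrected by a term which is
singular at the boundary. -/
def barrier (ln : Fin n) (A k R δ θ c : ℝ) (y : Eu n) : ℝ :=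
  A * Real.exp (-(k * ‖y - R • EuclideanSpace.single ln (1 : ℝ)‖ ^ 2))
    - δ * (y ln ^ 2 / 2) ^ (-θ) + c

lemma exists_mul_deriv_eq_sub {f f' : ℝ → ℝ} {s τ : ℝ} (hs : 0 < s) (hτ : τ ≠ 0)
    (hsτ : 0 < s - τ) (hf : ∀ r > 0, HasDerivAt f (f' r) r) :
    ∃ ζ, |ζ - s| ≤ |τ| ∧ τ * f' ζ = f s - f (s - τ) := by
  rcases lt_or_gt_of_ne hτ with h | h
  · obtain ⟨ζ, ⟨ha, hb⟩, he⟩ := exists_hasDerivAt_eq_slope f f' (show s < s - τ by linarith)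
      (fun r hr => (hf r (hs.trans_le hr.1)).continuousAt.continuousWithinAt)
      (fun r hr => hf r (hs.trans hr.1))
    refine ⟨ζ, ?_, ?_⟩
    · rw [abs_of_pos (by linarith), abs_of_neg h]
      linarith
    · rw [he, sub_sub_cancel_left]
      field_simp
      ring
  · obtain ⟨ζ, ⟨ha, hb⟩, he⟩ := exists_hasDerivAt_eq_slope f f' (show s - τ < s by linarith)
      (fun r hr => (hf r (hsτ.trans_le hr.1)).continuousAt.continuousWithinAt)
      (fun r hr => hf r (hsτ.trans hr.1))
    refine ⟨ζ, ?_, ?_⟩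
    · rw [abs_of_neg (by linarith), abs_of_pos h]
      linarith
    · rw [he, sub_sub_cancel]
      field_simp

/-- The second order difference inequality in the variable `s = y_n ^ 2 / 2`. -/
lemma difference_inequality {f f' : ℝ → ℝ} {b s τ h₁ h₂ p q ε : ℝ} (hs : 0 < s) (hτ : τ ≠ 0)
    (hsτ : 0 < s - τ) (hf : ∀ r > 0, HasDerivAt f (f' r) r)
    (h1 : f s - f (s - τ) = |τ| * h₁) (h2 : |τ| * h₂ ≤ f' s - f' (s - τ))
    (hp : 2 * s * f' s + (1 + b) * f s = -p)
    (hq : 2 * (s - τ) * f' (s - τ) + (1 + b) * f (s - τ) = -q)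
    (hε : ∀ r, |r - s| ≤ |τ| → |f' r - f' s| ≤ ε) :
    |τ| * (2 * s * h₂ + (3 + b) * h₁) ≤ q - p + 4 * ε * |τ| := by
  obtain ⟨ζ, hζ, hζe⟩ := exists_mul_deriv_eq_sub hs hτ hsτ hf
  have e1 := hε ζ hζ
  have e2 := hε (s - τ) (by rw [sub_sub_cancel_left, abs_neg])
  have e3 : 2 * τ * (f' ζ - f' (s - τ)) ≤ 4 * ε * |τ| := by
    have : |f' ζ - f' (s - τ)| ≤ 2 * ε := by
      calc |f' ζ - f' (s - τ)| = |(f' ζ - f' s) - (f' (s - τ) - f' s)| := by ring_nf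
        _ ≤ |f' ζ - f' s| + |f' (s - τ) - f' s| := abs_sub _ _
        _ ≤ _ := by linarith
    calc 2 * τ * (f' ζ - f' (s - τ)) ≤ |2 * τ * (f' ζ - f' (s - τ))| := le_abs_self _
      _ = 2 * |τ| * |f' ζ - f' (s - τ)| := by rw [abs_mul, abs_mul, abs_two]
      _ ≤ 2 * |τ| * (2 * ε) := by gcongr
      _ = _ := by ring
  have e4 : 2 * s * (|τ| * h₂) ≤ 2 * s * (f' s - f' (s - τ)) := by gcongr
  have e5 : (1 + b) * (f s - f (s - τ)) = (1 + b) * (|τ| * h₁) := by rw [h1]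
  linarith

lemma norm_sub_sq_normalLift (z : Eu n) {s : ℝ} (R : ℝ) :
    ‖normalLift ln z s - R • EuclideanSpace.single ln (1 : ℝ)‖ ^ 2
      = (fun i : {k : Fin n // k ≠ ln} => z i.1) ⬝ᵥ (fun i : {k : Fin n // k ≠ ln} => z i.1)
        + (√(2 * s) - R) ^ 2 := by
  rw [EuclideanSpace.norm_sq_eq, Fintype.sum_eq_add_sum_subtype_ne _ ln, add_comm]
  congr 1
  · refine Finset.sum_congr rfl fun i _ => ?_
    simp [normalLift, i.2, sq]
  · simp

lemma norm_sub_sq_eq {z : Eu n} (hz : 0 < z ln) (R : ℝ) :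
    ‖z - R • EuclideanSpace.single ln (1 : ℝ)‖ ^ 2
      = (fun i : {k : Fin n // k ≠ ln} => z i.1) ⬝ᵥ (fun i : {k : Fin n // k ≠ ln} => z i.1)
        + (z ln - R) ^ 2 := by
  have h := norm_sub_sq_normalLift (ln := ln) z (s := z ln ^ 2 / 2) R
  rwa [normalLift_self hz, mul_div_cancel₀ _ two_ne_zero, Real.sqrt_sq hz.le] at h

section Barrier

variable (A k R δ θ c : ℝ)

/-- First derivative of the barrier in the variable `s`, as a function of the squared tangential
radius `q` and of `s`. -/
def barrierDeriv (q s : ℝ) : ℝ :=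
  A * (-(k * (2 - 2 * R * (√(2 * s))⁻¹))) * Real.exp (-(k * (q + (√(2 * s) - R) ^ 2)))
    + δ * θ * s ^ (-θ - 1)

/-- Second derivative of the barrier in the variable `s`. -/
def barrierDeriv2 (q s : ℝ) : ℝ :=
  A * (k ^ 2 * (2 - 2 * R * (√(2 * s))⁻¹) ^ 2 - k * (2 * R * (√(2 * s))⁻¹ ^ 3)) *
      Real.exp (-(k * (q + (√(2 * s) - R) ^ 2)))
    - δ * θ * (θ + 1) * s ^ (-θ - 2)

variable {A k R δ θ c}

lemma hasDerivAt_barrier_exp (q : ℝ) {s : ℝ} (hs : 0 < s) :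
    HasDerivAt (fun s => Real.exp (-(k * (q + (√(2 * s) - R) ^ 2))))
      (-(k * (2 - 2 * R * (√(2 * s))⁻¹)) * Real.exp (-(k * (q + (√(2 * s) - R) ^ 2)))) s := by
  have h := (((((hasDerivAt_sqrt_two_mul hs).sub_const R).pow 2).const_add q).const_mul k).neg.exp
  refine h.congr_deriv ?_
  have : 0 < √(2 * s) := by positivity
  simp only [Pi.neg_apply, Pi.pow_apply, Nat.cast_ofNat, Nat.add_one_sub_one, pow_one]
  field_simp

lemma hasDerivAt_barrier (z : Eu n) {s : ℝ} (hs : 0 < s) :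
    HasDerivAt (fun s => barrier ln A k R δ θ c (normalLift ln z s))
      (barrierDeriv A k R δ θ ((fun i : {k : Fin n // k ≠ ln} => z i.1) ⬝ᵥ
        (fun i : {k : Fin n // k ≠ ln} => z i.1)) s) s := by
  set q := (fun i : {k : Fin n // k ≠ ln} => z i.1) ⬝ᵥ (fun i : {k : Fin n // k ≠ ln} => z i.1)
    with hq
  have h1 := (((hasDerivAt_barrier_exp (k := k) (R := R) q hs).const_mul A).sub
    ((Real.hasDerivAt_rpow_const (p := -θ) (Or.inl hs.ne')).const_mul δ)).add_const c
  have h2 : (fun s => barrier ln A k R δ θ c (normalLift ln z s)) =ᶠ[nhds s] fun s =>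
      A * Real.exp (-(k * (q + (√(2 * s) - R) ^ 2))) - δ * s ^ (-θ) + c := by
    filter_upwards [lt_mem_nhds hs] with r hr
    rw [barrier, norm_sub_sq_normalLift, sq_normalLift_apply hr.le]
  refine (h1.congr_of_eventuallyEq h2).congr_deriv ?_
  rw [barrierDeriv]
  ring

lemma hasDerivAt_barrierDeriv (q : ℝ) {s : ℝ} (hs : 0 < s) :
    HasDerivAt (barrierDeriv A k R δ θ q) (barrierDeriv2 A k R δ θ q s) s := by
  have ht : 0 < √(2 * s) := by positivity
  have h1 := ((((((hasDerivAt_sqrt_two_mul hs).inv ht.ne').const_mul (2 * R)).const_sub 2).const_mul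
    k).neg.const_mul A).mul (hasDerivAt_barrier_exp (k := k) (R := R) q hs)
  have h2 := h1.add ((Real.hasDerivAt_rpow_const (p := -θ - 1) (Or.inl hs.ne')).const_mul (δ * θ))
  refine HasDerivAt.congr_deriv (f := barrierDeriv A k R δ θ q) h2 ?_
  rw [barrierDeriv2, show -θ - 1 - 1 = -θ - 2 by ring]
  simp only [Pi.neg_apply, Pi.inv_apply]
  field_simp
  ring

lemma barrier_operator {b q s : ℝ} (hs : 0 < s) :
    2 * s * barrierDeriv2 A k R δ θ q s + (3 + b) * barrierDeriv A k R δ θ q s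
      = A * Real.exp (-(k * (q + (√(2 * s) - R) ^ 2))) * k *
          (4 * k * (√(2 * s) - R) ^ 2 - 2 * (3 + b) + 2 * (2 + b) * R * (√(2 * s))⁻¹)
        + δ * θ * (1 + b - 2 * θ) * s ^ (-θ - 1) := by
  have ht : 0 < √(2 * s) := by positivity
  have h2s : 2 * s = √(2 * s) ^ 2 := (Real.sq_sqrt (by positivity)).symm
  have hr : s * s ^ (-θ - 2) = s ^ (-θ - 1) := by
    rw [show -θ - 1 = 1 + (-θ - 2) by ring, Real.rpow_add hs, Real.rpow_one]
  rw [barrierDeriv2, barrierDeriv]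
  set E := Real.exp (-(k * (q + (√(2 * s) - R) ^ 2)))
  set t := √(2 * s)
  have ht1 : t * t⁻¹ = 1 := mul_inv_cancel₀ ht.ne'
  have e1 : 2 * s * (A * (k ^ 2 * (2 - 2 * R * t⁻¹) ^ 2 - k * (2 * R * t⁻¹ ^ 3)) * E)
      = A * E * k * (4 * k * (t - R) ^ 2 - 2 * R * t⁻¹) := by
    rw [h2s]
    field_simp
    ring
  linear_combination e1 - 2 * δ * θ * (θ + 1) * hr

end Barrier

/-- The difference quotient of `ψ` in the variable `s = y_n ^ 2 / 2`. -/
def normalQuotient (ψ : Eu n → ℝ) (ln : Fin n) (τ : ℝ) (y : Eu n) : ℝ :=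
  (ψ y - ψ (normalLift ln y (y ln ^ 2 / 2 - τ))) / |τ|

lemma normal_conditions_of_isLocalMin (hψ : ContDiffOn ℝ 2 ψ {y : Eu n | 0 < y ln})
    {A k R δ θ c τ : ℝ} (hτ : τ ≠ 0) {z : Eu n} (hz : 0 < z ln) (hsτ : 0 < z ln ^ 2 / 2 - τ)
    (hmin : IsLocalMin (fun y => normalQuotient ψ ln τ y - barrier ln A k R δ θ c y) z) :
    normalSlope ψ ln z - normalSlope ψ ln (normalLift ln z (z ln ^ 2 / 2 - τ))
        = |τ| * barrierDeriv A k R δ θ ((fun i : {k : Fin n // k ≠ ln} => z i.1) ⬝ᵥ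
        (fun i : {k : Fin n // k ≠ ln} => z i.1)) (z ln ^ 2 / 2) ∧
      |τ| * barrierDeriv2 A k R δ θ ((fun i : {k : Fin n // k ≠ ln} => z i.1) ⬝ᵥ
        (fun i : {k : Fin n // k ≠ ln} => z i.1)) (z ln ^ 2 / 2)
        ≤ normalSlopeDeriv ψ ln z - normalSlopeDeriv ψ ln (normalLift ln z (z ln ^ 2 / 2 - τ)) := by
  set q := (fun i : {k : Fin n // k ≠ ln} => z i.1) ⬝ᵥ (fun i : {k : Fin n // k ≠ ln} => z i.1)
  set s := z ln ^ 2 / 2 with hs_def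
  have hs : 0 < s := by positivity
  have hzs : normalLift ln z s = z := normalLift_self hz
  have hτ' : 0 < |τ| := abs_pos.2 hτ
  set G : ℝ → ℝ := fun r => (ψ (normalLift ln z r) - ψ (normalLift ln z (r - τ))) / |τ|
    - barrier ln A k R δ θ c (normalLift ln z r) with hG
  have hGmin : IsLocalMin G s := by
    have h1 := IsLocalMin.comp_continuous (g := normalLift ln z) (b := s) (by rwa [hzs])
      (hasDerivAt_normalLift hs z).continuousAt
    refine h1.congr ?_
    filter_upwards [lt_mem_nhds hs] with r hr
    simp only [Function.comp_apply, normalQuotient, hG]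
    rw [sq_normalLift_apply hr.le, normalLift_lift]
  have hd1 : ∀ r > 0, 0 < r - τ → HasDerivAt G ((normalSlope ψ ln (normalLift ln z r)
      - normalSlope ψ ln (normalLift ln z (r - τ))) / |τ| - barrierDeriv A k R δ θ q r) r := by
    intro r hr hrτ
    have h2 := (hasDerivAt_comp_lift hψ hrτ z).comp_sub_const r τ
    exact (((hasDerivAt_comp_lift hψ hr z).sub h2).div_const _).sub (hasDerivAt_barrier z hr)
  have hd2 : HasDerivAt (fun r => (normalSlope ψ ln (normalLift ln z r)
      - normalSlope ψ ln (normalLift ln z (r - τ))) / |τ| - barrierDeriv A k R δ θ q r)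
      ((normalSlopeDeriv ψ ln (normalLift ln z s)
      - normalSlopeDeriv ψ ln (normalLift ln z (s - τ))) / |τ| - barrierDeriv2 A k R δ θ q s) s := by
    have h2 := (hasDerivAt_normalSlope_lift hψ hsτ z).comp_sub_const s τ
    exact (((hasDerivAt_normalSlope_lift hψ hs z).sub h2).div_const _).sub
      (hasDerivAt_barrierDeriv q hs)
  have hev : ∀ᶠ r in nhds s, HasDerivAt G ((normalSlope ψ ln (normalLift ln z r)
      - normalSlope ψ ln (normalLift ln z (r - τ))) / |τ| - barrierDeriv A k R δ θ q r) r := by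
    filter_upwards [lt_mem_nhds hs, lt_mem_nhds (sub_pos.1 hsτ)] with r hr hr2
      using hd1 r hr (sub_pos.2 hr2)
  have e1 := hGmin.hasDerivAt_eq_zero (hd1 s hs hsτ)
  have e2 := second_deriv_nonneg_of_isLocalMin hev hd2 hGmin
  rw [hzs] at e1 e2
  constructor
  · field_simp at e1
    linarith
  · rw [sub_nonneg, le_div_iff₀ hτ'] at e2
    linarith

lemma tangential_condition_of_isLocalMin (hψ : ContDiffOn ℝ 2 ψ {y : Eu n | 0 < y ln})
    {A k R δ θ c τ : ℝ} (hτ : τ ≠ 0) {z : Eu n} (hz : 0 < z ln) (hsτ : 0 < z ln ^ 2 / 2 - τ)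
    (hmin : IsLocalMin (fun y => normalQuotient ψ ln τ y - barrier ln A k R δ θ c y) z)
    (ξ : {k : Fin n // k ≠ ln} → ℝ) :
    ξ ⬝ᵥ tangentialHessian ψ ln (normalLift ln z (z ln ^ 2 / 2 - τ)) *ᵥ ξ
      ≤ ξ ⬝ᵥ tangentialHessian ψ ln z *ᵥ ξ
        - |τ| * A * Real.exp (-(k * ‖z - R • EuclideanSpace.single ln (1 : ℝ)‖ ^ 2)) * (4 * k ^ 2)
          * ((fun i : {k : Fin n // k ≠ ln} => z i.1) ⬝ᵥ ξ) ^ 2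
        + |τ| * A * Real.exp (-(k * ‖z - R • EuclideanSpace.single ln (1 : ℝ)‖ ^ 2)) * (2 * k)
          * (ξ ⬝ᵥ ξ) := by
  set s := z ln ^ 2 / 2
  set z₂ := normalLift ln z (s - τ)
  have hz₂ : 0 < z₂ ln := normalLift_pos hsτ z
  have hτ' : 0 < |τ| := abs_pos.2 hτ
  set v : Eu n := extendTangential ξ with hv
  have hvn : v ln = 0 := extendTangential_apply_normal ξ
  set ρ := ‖z - R • EuclideanSpace.single ln (1 : ℝ)‖ ^ 2 with hρ
  set x := (fun i : {k : Fin n // k ≠ ln} => z i.1) ⬝ᵥ ξ with hx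
  set m := ξ ⬝ᵥ ξ with hm
  have hline : ∀ t : ℝ, ‖z + t • v - R • EuclideanSpace.single ln (1 : ℝ)‖ ^ 2
      = ρ + 2 * t * x + t ^ 2 * m := by
    intro t
    rw [add_sub_right_comm, norm_add_sq_real, ← hρ, norm_smul, mul_pow, norm_sq_extendTangential,
      inner_smul_right, inner_sub_left, inner_extendTangential, inner_smul_left,
      EuclideanSpace.inner_single_left, hvn]
    simp
    ring
  set G : ℝ → ℝ := fun t => (ψ (z + t • v) - ψ (z₂ + t • v)) / |τ|
    - (A * Real.exp (-(k * (ρ + 2 * t * x + t ^ 2 * m))) - δ * s ^ (-θ) + c) with hG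
  have hGmin : IsLocalMin G 0 := by
    have h1 := IsLocalMin.comp_continuous (g := fun t : ℝ => z + t • v) (b := 0)
      (by simpa using hmin) (Continuous.continuousAt (by fun_prop))
    refine h1.congr (Filter.Eventually.of_forall fun t => ?_)
    have htv : (t • v) ln = 0 := by simp [hvn]
    have hzt : (z + t • v) ln = z ln := by simp [hvn]
    simp only [Function.comp_apply, normalQuotient, hG, barrier]
    rw [hline, hzt, normalLift_add htv]
  set Ex : ℝ → ℝ := fun t => Real.exp (-(k * (ρ + 2 * t * x + t ^ 2 * m))) with hEx
  have hpoly : ∀ t, HasDerivAt (fun t : ℝ => -(k * (ρ + 2 * t * x + t ^ 2 * m)))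
      (-(k * (2 * x + 2 * t * m))) t := by
    intro t
    have h := ((((((hasDerivAt_id t).const_mul 2).mul_const x).const_add ρ).add
      (((hasDerivAt_id t).pow 2).mul_const m)).const_mul k).neg
    refine h.congr_deriv ?_
    simp
  have hdE : ∀ t, HasDerivAt Ex (Ex t * (-(k * (2 * x + 2 * t * m)))) t :=
    fun t => (hpoly t).exp
  have hd1 : ∀ t, HasDerivAt G ((fderiv ℝ ψ (z + t • v) v - fderiv ℝ ψ (z₂ + t • v) v) / |τ|
      - A * (Ex t * (-(k * (2 * x + 2 * t * m))))) t := fun t =>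
    (((hasDerivAt_comp_line hψ hz v t hvn).sub (hasDerivAt_comp_line hψ hz₂ v t hvn)).div_const
      _).sub ((((hdE t).const_mul A).sub_const _).add_const _)
  have hlin : HasDerivAt (fun t : ℝ => -(k * (2 * x + 2 * t * m))) (-(k * (2 * m))) 0 := by
    have h := (((((hasDerivAt_id (0 : ℝ)).const_mul 2).mul_const m).const_add (2 * x)).const_mul
      k).neg
    exact h.congr_deriv (by simp)
  have hd2 := (((hasDerivAt_fderiv_line hψ hz v).sub (hasDerivAt_fderiv_line hψ hz₂ v)).div_const
    |τ|).sub (((hdE 0).mul hlin).const_mul A)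
  have e := second_deriv_nonneg_of_isLocalMin (Filter.Eventually.of_forall hd1) hd2 hGmin
  rw [dotProduct_tangentialHessian hψ hz, dotProduct_tangentialHessian hψ hz₂]
  have hE0 : Ex 0 = Real.exp (-(k * ρ)) := by simp [hEx]
  rw [hE0, sub_nonneg, le_div_iff₀ hτ'] at e
  linarith

/-- The inequality satisfied at a point where the barrier touches the difference quotient from
below. -/
lemma IsHalfSpaceSolution.touching_inequality {b K₁ K₂ : ℝ}
    (h : IsHalfSpaceSolution ψ ln b K₁ K₂) (hK₂ : 0 < K₂)
    {A k R δ θ c τ ε : ℝ} (hA : 0 ≤ A) (hk : 0 ≤ k) (hτ : τ ≠ 0) {z : Eu n} (hz : 0 < z ln)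
    (hsτ : 0 < z ln ^ 2 / 2 - τ)
    (hε : ∀ s, |s - z ln ^ 2 / 2| ≤ |τ| →
      |normalSlopeDeriv ψ ln (normalLift ln z s) - normalSlopeDeriv ψ ln z| ≤ ε)
    (hmin : IsLocalMin (fun y => normalQuotient ψ ln τ y - barrier ln A k R δ θ c y) z)
    {q E T : ℝ} (hq : q = (fun i : {k : Fin n // k ≠ ln} => z i.1) ⬝ᵥ
      (fun i : {k : Fin n // k ≠ ln} => z i.1))
    (hE : E = Real.exp (-(k * ‖z - R • EuclideanSpace.single ln (1 : ℝ)‖ ^ 2)))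
    (hT : T = A * E * (4 * k ^ 2 * q / K₁ - 2 * k * Fintype.card {k : Fin n // k ≠ ln} * K₂)) :
    |τ| * (A * E * k * (4 * k * (z ln - R) ^ 2 - 2 * (3 + b) + 2 * (2 + b) * R * (z ln)⁻¹)
        + δ * θ * (1 + b - 2 * θ) * (z ln ^ 2 / 2) ^ (-θ - 1))
      ≤ (tangentialHessian ψ ln z).det * (Real.exp (-(|τ| * T)) - 1) + 4 * ε * |τ| := by
  have hψ := h.contDiffOn
  have hs : 0 < z ln ^ 2 / 2 := by positivity
  have hτ' : 0 < |τ| := abs_pos.2 hτ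
  have hEpos : 0 < E := hE ▸ Real.exp_pos _
  have hz₂ : 0 < normalLift ln z (z ln ^ 2 / 2 - τ) ln := normalLift_pos hsτ z
  have hzs : normalLift ln z (z ln ^ 2 / 2) = z := normalLift_self hz
  obtain ⟨c1, c2⟩ := normal_conditions_of_isLocalMin hψ hτ hz hsτ hmin
  have hp := h.equation_lift hz
  have hq' := h.equation_lift hz₂
  rw [sq_normalLift_apply hsτ.le] at hq'
  have hdiff := difference_inequality (f := fun r => normalSlope ψ ln (normalLift ln z r))
    (f' := fun r => normalSlopeDeriv ψ ln (normalLift ln z r)) hs hτ hsτ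
    (fun r hr => hasDerivAt_normalSlope_lift hψ hr z) (by simpa only [hzs] using c1)
    (by simpa only [hzs] using c2) (by simpa only [hzs] using hp) hq'
    (by simpa only [hzs] using hε)
  rw [barrier_operator hs, mul_div_cancel₀ _ two_ne_zero, Real.sqrt_sq hz.le, ← hq, hq,
    ← norm_sub_sq_eq hz, ← hE] at hdiff
  have hdet := (h.posDef z hz).det_le_det_mul_exp (h.posDef _ hz₂).posSemidef hK₂
    (α := |τ| * A * E * (4 * k ^ 2)) (c := |τ| * A * E * (2 * k)) (by positivity) (by positivity)
    (h.lower_le z hz) (h.le_upper z hz) (fun i => z i.1) (by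
      rw [hE]
      exact tangential_condition_of_isLocalMin hψ hτ hz hsτ hmin)
  rw [← hq] at hdet
  have hTe : |τ| * A * E * (4 * k ^ 2) * q / K₁
      - |τ| * A * E * (2 * k) * Fintype.card {k : Fin n // k ≠ ln} * K₂ = |τ| * T := by
    rw [hT]
    ring
  rw [hTe] at hdet
  linarith

lemma exists_normalQuotient_eq (hψ : ContDiffOn ℝ 2 ψ {y : Eu n | 0 < y ln}) {σ t : ℝ}
    (hσ : σ = 1 ∨ σ = -1) (ht : 0 < t) {y : Eu n} (hy : 0 < y ln)
    (hyt : 0 < y ln ^ 2 / 2 - σ * t) :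
    ∃ ζ, |ζ - y ln ^ 2 / 2| ≤ t ∧
      normalQuotient ψ ln (σ * t) y = σ * normalSlope ψ ln (normalLift ln y ζ) := by
  have hσt : |σ * t| = t := by
    rcases hσ with rfl | rfl <;> simp [abs_of_pos ht]
  have hne : σ * t ≠ 0 := abs_pos.1 (by rwa [hσt])
  obtain ⟨ζ, h1, h2⟩ := exists_mul_deriv_eq_sub (s := y ln ^ 2 / 2) (by positivity) hne hyt
    fun r hr => hasDerivAt_comp_lift hψ hr y
  rw [normalLift_self hy] at h2
  refine ⟨ζ, hσt ▸ h1, ?_⟩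
  rw [normalQuotient, ← h2, hσt]
  field_simp

lemma continuousAt_normalQuotient (hψ : ContDiffOn ℝ 2 ψ {y : Eu n | 0 < y ln}) {τ : ℝ} {y : Eu n}
    (hy : 0 < y ln) (hyτ : 0 < y ln ^ 2 / 2 - τ) : ContinuousAt (normalQuotient ψ ln τ) y := by
  have hlift : ContinuousAt (fun y : Eu n => normalLift ln y (y ln ^ 2 / 2 - τ)) y := by
    unfold normalLift
    exact Continuous.continuousAt (by fun_prop)
  refine ContinuousAt.div_const (ContinuousAt.sub ?_ ?_) _
  · exact (hasFDerivAt_of_contDiffOn hψ hy).continuousAt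
  · exact ContinuousAt.comp (f := fun y : Eu n => normalLift ln y (y ln ^ 2 / 2 - τ))
      (hasFDerivAt_of_contDiffOn hψ (normalLift_pos hyτ y)).continuousAt hlift

lemma continuousAt_barrier (A k R δ θ c : ℝ) {y : Eu n} (hy : 0 < y ln) :
    ContinuousAt (barrier ln A k R δ θ c) y := by
  unfold barrier
  refine ContinuousAt.add (ContinuousAt.sub (Continuous.continuousAt (by fun_prop))
    (ContinuousAt.const_mul ?_ _)) continuousAt_const
  exact ContinuousAt.rpow_const (Continuous.continuousAt (by fun_prop)) (Or.inl (by positivity))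

lemma barrier_le_of_le {A k R δ θ c : ℝ} (hA : 0 < A) (hk : 0 ≤ k) (hδ : 0 < δ) (hθ : 0 < θ) :
    ∃ ε₀ > 0, ∀ y : Eu n, 0 < y ln → y ln ≤ ε₀ → barrier ln A k R δ θ c y ≤ c := by
  set s₀ := (δ / A) ^ θ⁻¹ with hs₀
  have hs₀' : 0 < s₀ := by positivity
  have hpow : s₀ ^ (-θ) = A / δ := by
    rw [hs₀, ← Real.rpow_mul (by positivity), mul_neg, inv_mul_cancel₀ hθ.ne', Real.rpow_neg_one,
      inv_div]
  refine ⟨√(2 * s₀), by positivity, fun y hy hle => ?_⟩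
  have h1 : y ln ^ 2 / 2 ≤ s₀ := by
    have := pow_le_pow_left₀ hy.le hle 2
    rw [Real.sq_sqrt (by positivity)] at this
    linarith
  have h2 : A / δ ≤ (y ln ^ 2 / 2) ^ (-θ) := by
    rw [← hpow]
    exact Real.rpow_le_rpow_of_nonpos (by positivity) h1 (by linarith)
  have h3 : A ≤ δ * (y ln ^ 2 / 2) ^ (-θ) := by
    rw [div_le_iff₀ hδ] at h2
    linarith
  have h4 : A * Real.exp (-(k * ‖y - R • EuclideanSpace.single ln (1 : ℝ)‖ ^ 2)) ≤ A :=
    mul_le_of_le_one_right hA.le (Real.exp_le_one_iff.2 (by simp; positivity))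
  rw [barrier]
  linarith

lemma barrier_le_of_le_norm {A k R δ θ c μ : ℝ} (hA : 0 < A) (hk : 0 < k) (hδ : 0 < δ)
    (hμ : 0 < μ) :
    ∃ B > 0, ∀ y : Eu n, 0 < y ln → B ≤ ‖y - R • EuclideanSpace.single ln (1 : ℝ)‖ →
      barrier ln A k R δ θ (c - μ) y ≤ c := by
  refine ⟨√(A / (μ * k)), by positivity, fun y hy hle => ?_⟩
  have h1 := pow_le_pow_left₀ (by positivity) hle 2
  rw [Real.sq_sqrt (by positivity), div_le_iff₀ (by positivity)] at h1
  set ρ := ‖y - R • EuclideanSpace.single ln (1 : ℝ)‖ ^ 2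
  have h2 : A * Real.exp (-(k * ρ)) ≤ μ := by
    rw [Real.exp_neg, ← div_eq_mul_inv, div_le_iff₀ (Real.exp_pos _)]
    have := mul_le_mul_of_nonneg_left (Real.add_one_le_exp (k * ρ)) hμ.le
    nlinarith
  have h3 : 0 ≤ δ * (y ln ^ 2 / 2) ^ (-θ) := by positivity
  rw [barrier]
  linarith

/-- The zeroth and first order terms produced by the Gaussian part of the barrier are nonnegative
away from its centre. -/
lemma gaussian_operator_nonneg {A E k K₁ K₂ b x q D D₀ N r l Y : ℝ} (hA : 0 ≤ A) (hE : 0 ≤ E)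
    (hk : 0 ≤ k) (hK₁ : 0 < K₁) (hK₂ : 0 ≤ K₂) (hq : 0 ≤ q) (hN : 0 ≤ N) (hY : 0 ≤ Y)
    (hl : 0 ≤ l) (hl1 : l ≤ 1) (hlD : l * K₁ ≤ D) (hD : D ≤ D₀) (hr : r ^ 2 ≤ q + x ^ 2)
    (hk4 : 2 * (3 + b) + 2 * D₀ * N * K₂ ≤ 4 * k * l * r ^ 2) :
    0 ≤ A * E * k * (4 * k * x ^ 2 - 2 * (3 + b) + Y)
      + D * (A * E * (4 * k ^ 2 * q / K₁ - 2 * k * N * K₂)) := by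
  have h1 : l * q ≤ D * (q / K₁) := by
    calc l * q = l * K₁ * (q / K₁) := by field_simp
      _ ≤ _ := by gcongr
  have h2 : l * r ^ 2 ≤ x ^ 2 + D * (q / K₁) := by
    calc l * r ^ 2 ≤ l * (q + x ^ 2) := by gcongr
      _ = l * q + l * x ^ 2 := by ring
      _ ≤ D * (q / K₁) + 1 * x ^ 2 := by gcongr
      _ = _ := by ring
  have h3 : D * (N * K₂) ≤ D₀ * (N * K₂) := by gcongr
  have h4 : 4 * k * (l * r ^ 2) ≤ 4 * k * (x ^ 2 + D * (q / K₁)) := by gcongr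
  have h5 : 0 ≤ A * E * k *
      (4 * k * (x ^ 2 + D * (q / K₁)) - 2 * (3 + b) - 2 * (D * (N * K₂)) + Y) := by
    refine mul_nonneg (by positivity) ?_
    linarith
  calc 0 ≤ _ := h5
    _ = _ := by ring

lemma le_of_exp_inequality {t G S T T₀ D D₀ ε : ℝ} (ht : 0 < t) (hD : 0 ≤ D) (hD₀ : D ≤ D₀)
    (hT : |T| ≤ T₀) (htT : t * T₀ ≤ 1) (hG : 0 ≤ G + D * T)
    (h : t * (G + S) ≤ D * (Real.exp (-(t * T)) - 1) + 4 * ε * t) :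
    S ≤ t * (D₀ * T₀ ^ 2) + 4 * ε := by
  have h1 : |-(t * T)| ≤ 1 := by
    rw [abs_neg, abs_mul, abs_of_pos ht]
    exact (mul_le_mul_of_nonneg_left hT ht.le).trans htT
  have h2 := (abs_le.1 (Real.abs_exp_sub_one_sub_id_le h1)).2
  have h3 : T ^ 2 ≤ T₀ ^ 2 := sq_le_sq.2 (hT.trans (le_abs_self _))
  have h4 : Real.exp (-(t * T)) - 1 ≤ -(t * T) + t ^ 2 * T₀ ^ 2 := by
    have : t ^ 2 * T ^ 2 ≤ t ^ 2 * T₀ ^ 2 := by gcongr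
    linarith
  have h5 : D * (Real.exp (-(t * T)) - 1) ≤ D * -(t * T) + D₀ * (t ^ 2 * T₀ ^ 2) := by
    calc _ ≤ D * (-(t * T) + t ^ 2 * T₀ ^ 2) := by gcongr
      _ = D * -(t * T) + D * (t ^ 2 * T₀ ^ 2) := by ring
      _ ≤ _ := by gcongr
  have h6 : t * S ≤ t * (t * (D₀ * T₀ ^ 2) + 4 * ε) := by
    have := mul_nonneg ht.le hG
    linarith
  exact le_of_mul_le_mul_left h6 ht

/-- The barrier stays below `±normalSlope` in the whole half-space. -/
lemma IsHalfSpaceSolution.barrier_le {b K₁ K₂ : ℝ} (h : IsHalfSpaceSolution ψ ln b K₁ K₂)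
    (hK₁ : 0 < K₁) (hK₂ : 0 < K₂) {σ : ℝ} (hσ : σ = 1 ∨ σ = -1)
    {a k R r l δ θ m μ : ℝ} (ha : 0 < a) (hk : 0 < k) (hR : 0 < R) (hr : 0 ≤ r) (hδ : 0 < δ)
    (hθ : 0 < θ) (hθb : 2 * θ < 1 + b) (hμ : 0 < μ) (hl : 0 ≤ l) (hl1 : l ≤ 1)
    (hlK : l * K₁ ≤ K₂⁻¹ ^ Fintype.card {k : Fin n // k ≠ ln})
    (hk4 : 2 * (3 + b) + 2 * K₁ ^ Fintype.card {k : Fin n // k ≠ ln} *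
      Fintype.card {k : Fin n // k ≠ ln} * K₂ ≤ 4 * k * l * r ^ 2)
    (hm : ∀ y : Eu n, 0 < y ln → m ≤ σ * normalSlope ψ ln y)
    (hma : ∀ y : Eu n, 0 < y ln → ‖y - R • EuclideanSpace.single ln (1 : ℝ)‖ ≤ r →
      m + a ≤ σ * normalSlope ψ ln y) {p : Eu n} (hp : 0 < p ln) :
    barrier ln a k R δ θ (m - μ) p ≤ σ * normalSlope ψ ln p := by
  have hψ := h.contDiffOn
  by_contra! hcon
  set N := Fintype.card {k : Fin n // k ≠ ln}
  set e := R • EuclideanSpace.single ln (1 : ℝ) with he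
  set F := barrier ln a k R δ θ (m - μ) with hF
  obtain ⟨ε₀, hε₀, hbot⟩ := barrier_le_of_le (n := n) (ln := ln) (R := R) (c := m - μ)
    ha hk.le hδ hθ
  obtain ⟨B, hB, hout⟩ := barrier_le_of_le_norm (n := n) (ln := ln) (R := R) (θ := θ) (c := m)
    ha hk hδ hμ
  have hin : ∀ y : Eu n, 0 < y ln → σ * normalSlope ψ ln y < F y → ε₀ < y ln ∧ ‖y - e‖ < B := by
    intro y hy hlt
    have := (hm y hy).trans_lt hlt
    constructor
    · by_contra! hc
      linarith [hbot y hy hc]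
    · by_contra! hc
      linarith [hout y hy hc]
  set K : Set (Eu n) := Metric.closedBall e B ∩ {y : Eu n | ε₀ ≤ y ln} with hKdef
  have hK : IsCompact K := (isCompact_closedBall e B).inter_right
    (isClosed_le continuous_const (by fun_prop))
  have hKε : ∀ y ∈ K, ε₀ ≤ y ln := fun y hy => hy.2
  have hpK : p ∈ K :=
    ⟨by simpa [dist_eq_norm] using (hin p hp hcon).2.le, (hin p hp hcon).1.le⟩
  set c₀ := δ * θ * (1 + b - 2 * θ) * ((R + B) ^ 2 / 2) ^ (-θ - 1) with hc₀
  have hc₀pos : 0 < c₀ := by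
    have : 0 < 1 + b - 2 * θ := by linarith
    positivity
  set T₀ := a * (4 * k ^ 2 * B ^ 2 / K₁ + 2 * k * N * K₂) + 1 with hT₀
  have hT₀pos : 0 < T₀ := by positivity
  set η := (F p - σ * normalSlope ψ ln p) / 3 with hη
  have hηpos : 0 < η := by linarith
  obtain ⟨τ₁, hτ₁, hclose₁⟩ := exists_lift_close hK hε₀ hKε
    (fun y hy => continuousAt_normalSlope hψ hy) hηpos
  obtain ⟨τ₂, hτ₂, hclose₂⟩ := exists_lift_close hK hε₀ hKε
    (fun y hy => continuousAt_normalSlopeDeriv hψ hy) (show 0 < c₀ / 16 by positivity)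
  obtain ⟨t, ht, htlt⟩ := exists_between (show
    0 < min τ₁ (min τ₂ (min (ε₀ ^ 2 / 2) (min T₀⁻¹ (c₀ / (4 * (K₁ ^ N * T₀ ^ 2)))))) by positivity)
  simp only [lt_min_iff] at htlt
  obtain ⟨ht1, ht2, ht3, ht4, ht5⟩ := htlt
  have hστ : |σ * t| = t := by rcases hσ with rfl | rfl <;> simp [abs_of_pos ht]
  have hστ0 : σ * t ≠ 0 := abs_pos.1 (by rwa [hστ])
  have hKt : ∀ y ∈ K, 0 < y ln ∧ 0 < y ln ^ 2 / 2 - σ * t := by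
    intro y hy
    refine ⟨hε₀.trans_le hy.2, ?_⟩
    have := pow_le_pow_left₀ hε₀.le hy.2 2
    have := le_abs_self (σ * t)
    linarith
  have hnear : ∀ y ∈ K, |normalQuotient ψ ln (σ * t) y - σ * normalSlope ψ ln y| < η := by
    intro y hy
    obtain ⟨ζ, hζ, hζe⟩ := exists_normalQuotient_eq hψ hσ ht (hKt y hy).1 (hKt y hy).2
    have hσ1 : |σ| = 1 := by rcases hσ with rfl | rfl <;> simp
    rw [hζe, ← mul_sub, abs_mul, hσ1, one_mul]
    exact hclose₁ y hy ζ (hζ.trans_lt ht1)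
  obtain ⟨z, hzK, hzmin⟩ := hK.exists_isMinOn ⟨p, hpK⟩
    (f := fun y => normalQuotient ψ ln (σ * t) y - F y) fun y hy =>
      ((continuousAt_normalQuotient hψ (hKt y hy).1 (hKt y hy).2).sub
        (continuousAt_barrier _ _ _ _ _ _ (hKt y hy).1)).continuousWithinAt
  obtain ⟨hz, hzt⟩ := hKt z hzK
  have hzF : σ * normalSlope ψ ln z < F z := by
    have h1 := (abs_lt.1 (hnear z hzK)).1
    have h2 := (abs_lt.1 (hnear p hpK)).2
    have h3 := isMinOn_iff.1 hzmin p hpK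
    linarith
  obtain ⟨hzε, hzB⟩ := hin z hz hzF
  have hnhds : K ∈ nhds z := by
    refine Filter.inter_mem (Metric.closedBall_mem_nhds_of_mem ?_) ?_
    · simpa [dist_eq_norm] using hzB
    · filter_upwards [(isOpen_lt continuous_const (by fun_prop : Continuous fun y : Eu n =>
        y ln)).mem_nhds hzε] with y hy using le_of_lt hy
  have hlocal : IsLocalMin (fun y => normalQuotient ψ ln (σ * t) y - F y) z :=
    hzmin.isLocalMin hnhds
  set E := Real.exp (-(k * ‖z - e‖ ^ 2)) with hE
  have hE1 : E ≤ 1 := Real.exp_le_one_iff.2 (by simp; positivity)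
  have hE0 : 0 < E := Real.exp_pos _
  have hzr : r < ‖z - e‖ := by
    by_contra! hc
    have h1 := hma z hz hc
    have h2 : F z = a * E - δ * (z ln ^ 2 / 2) ^ (-θ) + (m - μ) := rfl
    have h3 : 0 < δ * (z ln ^ 2 / 2) ^ (-θ) := by positivity
    have h4 : a * E ≤ a := mul_le_of_le_one_right ha.le hE1
    linarith
  have hnorm := norm_sub_sq_eq hz R
  set q := (fun i : {k : Fin n // k ≠ ln} => z i.1) ⬝ᵥ (fun i : {k : Fin n // k ≠ ln} => z i.1)
    with hq
  have hq0 : 0 ≤ q := Finset.sum_nonneg fun i _ => mul_self_nonneg _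
  have hsqB : ‖z - e‖ ^ 2 ≤ B ^ 2 := by gcongr
  have hzn : z ln ≤ R + B := by
    have : (z ln - R) ^ 2 ≤ B ^ 2 := by linarith
    linarith [abs_le_of_sq_le_sq' this hB.le]
  have hqB : q ≤ B ^ 2 := by
    have := sq_nonneg (z ln - R)
    linarith
  obtain ⟨hdet1, hdet2⟩ := (h.posDef z hz).isHermitian.det_mem_Icc (inv_nonneg.2 hK₂.le)
    (h.lower_le z hz) (h.le_upper z hz)
  set D := (tangentialHessian ψ ln z).det
  have htouch := h.touching_inequality hK₂ ha.le hk.le hστ0 hz hzt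
    (ε := c₀ / 16) (fun s hs => (hclose₂ z hzK s (by linarith)).le) hlocal hq hE rfl
  rw [hστ] at htouch
  have hS := le_of_exp_inequality (T₀ := T₀) ht ((by positivity : (0 : ℝ) ≤ K₂⁻¹ ^ N).trans hdet1)
    hdet2 ?_ ?_ ?_ htouch
  · have hS' : c₀ ≤ δ * θ * (1 + b - 2 * θ) * (z ln ^ 2 / 2) ^ (-θ - 1) := by
      have h1 : 0 ≤ 1 + b - 2 * θ := by linarith
      have h2 : ((R + B) ^ 2 / 2) ^ (-θ - 1) ≤ (z ln ^ 2 / 2) ^ (-θ - 1) :=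
        Real.rpow_le_rpow_of_nonpos (by positivity) (by gcongr) (by linarith)
      rw [hc₀]
      gcongr
    rw [lt_div_iff₀ (by positivity)] at ht5
    linarith
  · have h1 : 0 ≤ a * E * (4 * k ^ 2 * q / K₁) := by positivity
    have h2 : 0 ≤ a * E * (2 * k * N * K₂) := by positivity
    have h3 : a * E * (4 * k ^ 2 * q / K₁) ≤ a * 1 * (4 * k ^ 2 * B ^ 2 / K₁) := by gcongr
    have h4 : a * E * (2 * k * N * K₂) ≤ a * 1 * (2 * k * N * K₂) := by gcongr
    have h5 : 0 ≤ a * (4 * k ^ 2 * B ^ 2 / K₁) := by positivity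
    have h6 : 0 ≤ a * (2 * k * N * K₂) := by positivity
    rw [abs_le, mul_sub, hT₀]
    constructor <;> linarith
  · rw [lt_inv_comm₀ ht hT₀pos] at ht4
    rw [mul_comm, ← le_div_iff₀ ht, one_div]
    exact ht4.le
  · refine gaussian_operator_nonneg ha.le hE0.le hk.le hK₁ hK₂.le hq0 (Nat.cast_nonneg _) ?_ hl hl1
      (hlK.trans hdet1) hdet2 ?_ hk4
    · have : 0 ≤ 2 + b := by linarith
      positivity
    · rw [← hnorm]
      gcongr

lemma IsHalfSpaceSolution.gaussian_le {b K₁ K₂ : ℝ} (h : IsHalfSpaceSolution ψ ln b K₁ K₂)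
    (hb : -1 < b) (hK₁ : 0 < K₁) (hK₂ : 0 < K₂) {σ : ℝ} (hσ : σ = 1 ∨ σ = -1)
    {a k R r l m : ℝ} (ha : 0 < a) (hk : 0 < k) (hR : 0 < R) (hr : 0 ≤ r) (hl : 0 ≤ l)
    (hl1 : l ≤ 1) (hlK : l * K₁ ≤ K₂⁻¹ ^ Fintype.card {k : Fin n // k ≠ ln})
    (hk4 : 2 * (3 + b) + 2 * K₁ ^ Fintype.card {k : Fin n // k ≠ ln} *
      Fintype.card {k : Fin n // k ≠ ln} * K₂ ≤ 4 * k * l * r ^ 2)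
    (hm : ∀ y : Eu n, 0 < y ln → m ≤ σ * normalSlope ψ ln y)
    (hma : ∀ y : Eu n, 0 < y ln → ‖y - R • EuclideanSpace.single ln (1 : ℝ)‖ ≤ r →
      m + a ≤ σ * normalSlope ψ ln y) {p : Eu n} (hp : 0 < p ln) :
    m + a * Real.exp (-(k * ‖p - R • EuclideanSpace.single ln (1 : ℝ)‖ ^ 2))
      ≤ σ * normalSlope ψ ln p := by
  refine le_of_forall_pos_le_add fun ε hε => ?_
  set x := (p ln ^ 2 / 2) ^ (-((1 + b) / 4)) with hx
  have hxpos : 0 < x := by positivity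
  have hle := h.barrier_le hK₁ hK₂ hσ (δ := ε / (2 * x)) (θ := (1 + b) / 4) (μ := ε / 2) ha hk hR
    hr (by positivity) (by linarith) (by linarith) (by positivity) hl hl1 hlK hk4 hm hma hp
  rw [barrier, ← hx] at hle
  have : ε / (2 * x) * x = ε / 2 := by field_simp
  linarith

/-- A gain on a ball at height `R` improves a one-sided bound on the whole ball of radius `2 * R`
around its centre. -/
lemma IsHalfSpaceSolution.exists_improvement {b K₁ K₂ : ℝ} (h : IsHalfSpaceSolution ψ ln b K₁ K₂)
    (hb : -1 < b) (hK₁ : 0 < K₁) (hK₂ : 0 < K₂) {κ : ℝ} (hκ : 0 < κ) :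
    ∃ c > 0, ∀ σ : ℝ, (σ = 1 ∨ σ = -1) → ∀ a m R : ℝ, 0 < a → 0 < R →
      (∀ y : Eu n, 0 < y ln → m ≤ σ * normalSlope ψ ln y) →
      (∀ y : Eu n, 0 < y ln → ‖y - R • EuclideanSpace.single ln (1 : ℝ)‖ ≤ κ * R →
        m + a ≤ σ * normalSlope ψ ln y) →
      ∀ p : Eu n, 0 < p ln → ‖p - R • EuclideanSpace.single ln (1 : ℝ)‖ ≤ 2 * R →
        m + c * a ≤ σ * normalSlope ψ ln p := by
  set N := Fintype.card {k : Fin n // k ≠ ln}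
  set X := 2 * (3 + b) + 2 * K₁ ^ N * N * K₂ with hX
  have hXpos : 0 < X := by
    have h1 : 0 < 3 + b := by linarith
    positivity
  set l := min 1 (K₂⁻¹ ^ N / K₁) with hl
  have hlpos : 0 < l := by positivity
  set Γ := X / (4 * l * κ ^ 2) with hΓ
  have hΓpos : 0 < Γ := by positivity
  refine ⟨Real.exp (-(Γ * 4)), Real.exp_pos _, fun σ hσ a m R ha hR hm hma p hp hpR => ?_⟩
  have hle := h.gaussian_le hb hK₁ hK₂ hσ (k := Γ / R ^ 2) (r := κ * R) (l := l) ha (by positivity)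
    hR (by positivity) hlpos.le (min_le_left _ _) ((le_div_iff₀ hK₁).1 (min_le_right _ _))
    (le_of_eq (by rw [← hX, hΓ]; field_simp)) hm hma hp
  refine le_trans ?_ hle
  rw [mul_comm]
  gcongr m + a * Real.exp (-?_)
  calc Γ / R ^ 2 * ‖p - R • EuclideanSpace.single ln (1 : ℝ)‖ ^ 2
      ≤ Γ / R ^ 2 * (2 * R) ^ 2 := by gcongr
    _ = Γ * 4 := by
      field_simp
      norm_num

/-- Liouville property: `∂ψ/∂y_n / y_n` is constant as soon as it is bounded and Lipschitz at every
scale. -/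
theorem IsHalfSpaceSolution.normalSlope_eq {b K₁ K₂ L : ℝ} (h : IsHalfSpaceSolution ψ ln b K₁ K₂)
    (hb : -1 < b) (hK₁ : 0 < K₁) (hK₂ : 0 < K₂) (hL : 0 ≤ L)
    (hbd : ∀ y : Eu n, 0 < y ln → |normalSlope ψ ln y| ≤ L)
    (hosc : ∀ κ R : ℝ, κ ≤ 1 / 2 → 0 < R → ∀ y : Eu n, 0 < y ln →
      ‖y - R • EuclideanSpace.single ln (1 : ℝ)‖ ≤ κ * R →
      |normalSlope ψ ln y - normalSlope ψ ln (R • EuclideanSpace.single ln (1 : ℝ))| ≤ 4 * L * κ)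
    {y z : Eu n} (hy : 0 < y ln) (hz : 0 < z ln) : normalSlope ψ ln y = normalSlope ψ ln z := by
  set S := normalSlope ψ ln '' {y : Eu n | 0 < y ln} with hS
  have hne : S.Nonempty := ⟨_, y, hy, rfl⟩
  have hba : BddAbove S := ⟨L, by rintro _ ⟨x, hx, rfl⟩; exact (abs_le.1 (hbd x hx)).2⟩
  have hbb : BddBelow S := ⟨-L, by rintro _ ⟨x, hx, rfl⟩; exact (abs_le.1 (hbd x hx)).1⟩
  have hup : ∀ x : Eu n, 0 < x ln → normalSlope ψ ln x ≤ sSup S := fun x hx =>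
    le_csSup hba ⟨x, hx, rfl⟩
  have hlow : ∀ x : Eu n, 0 < x ln → sInf S ≤ normalSlope ψ ln x := fun x hx =>
    csInf_le hbb ⟨x, hx, rfl⟩
  suffices hA : sSup S - sInf S ≤ 0 by
    linarith [hup y hy, hup z hz, hlow y hy, hlow z hz]
  by_contra! hA
  set A := sSup S - sInf S with hAdef
  set κ := min (1 / 2) (A / (16 * (L + 1))) with hκ
  have hκpos : 0 < κ := by positivity
  have hκA : 4 * L * κ ≤ A / 4 := by
    have h1 : κ * (16 * (L + 1)) ≤ A := (le_div_iff₀ (by positivity)).1 (min_le_right _ _)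
    linarith
  obtain ⟨c, hc, himp⟩ := h.exists_improvement hb hK₁ hK₂ hκpos
  have key : ∀ σ : ℝ, (σ = 1 ∨ σ = -1) → ∀ m : ℝ,
      (∀ x : Eu n, 0 < x ln → m ≤ σ * normalSlope ψ ln x) →
      (∃ᶠ R : ℝ in Filter.atTop, m + A / 2 ≤
        σ * normalSlope ψ ln (R • EuclideanSpace.single ln (1 : ℝ))) →
      ∀ p : Eu n, 0 < p ln → m + c * (A / 4) ≤ σ * normalSlope ψ ln p := by
    intro σ hσ m hm hfreq p hp
    obtain ⟨R, hR, hRw⟩ := Filter.frequently_atTop.1 hfreq (max 1 ‖p‖)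
    have hR1 : 0 < R := one_pos.trans_le ((le_max_left _ _).trans hR)
    have hRp : ‖p‖ ≤ R := (le_max_right _ _).trans hR
    refine himp σ hσ (A / 4) m R (by positivity) hR1 hm (fun x hx hxR => ?_) p hp ?_
    · have h1 : |σ * normalSlope ψ ln x
          - σ * normalSlope ψ ln (R • EuclideanSpace.single ln (1 : ℝ))| ≤ A / 4 := by
        have hσ1 : |σ| = 1 := by rcases hσ with rfl | rfl <;> simp
        rw [← mul_sub, abs_mul, hσ1, one_mul]
        exact (hosc κ R (min_le_left _ _) hR1 x hx hxR).trans hκA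
      linarith [(abs_le.1 h1).1]
    · calc _ ≤ ‖p‖ + ‖R • EuclideanSpace.single ln (1 : ℝ)‖ := norm_sub_le _ _
        _ = ‖p‖ + R := by simp [norm_smul, abs_of_pos hR1]
        _ ≤ 2 * R := by linarith
  have hgain : 0 < c * (A / 4) := by positivity
  by_cases hfreq : ∃ᶠ R : ℝ in Filter.atTop, sInf S + A / 2 ≤
      normalSlope ψ ln (R • EuclideanSpace.single ln (1 : ℝ))
  · have h1 : sInf S + c * (A / 4) ≤ sInf S := le_csInf hne (by
      rintro _ ⟨x, hx, rfl⟩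
      simpa using key 1 (Or.inl rfl) (sInf S) (by simpa using hlow) (by simpa using hfreq) x hx)
    linarith
  · have hev := Filter.not_frequently.1 hfreq
    have h1 : sSup S ≤ sSup S - c * (A / 4) := csSup_le hne (by
      rintro _ ⟨x, hx, rfl⟩
      have := key (-1) (Or.inr rfl) (-sSup S) (fun x hx => by linarith [hup x hx])
        (Filter.Eventually.frequently (hev.mono fun R hR => by linarith)) x hx
      linarith)
    linarith

end Touching

section Gradient

variable {n : ℕ} {ψ : Eu n → ℝ} {ln : Fin n}

lemma abs_normalSlope_le {L : ℝ} (hpd : ∀ y : Eu n, 0 < y ln → |pd ψ ln y| ≤ L * y ln) {y : Eu n}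
    (hy : 0 < y ln) : |normalSlope ψ ln y| ≤ L := by
  rw [normalSlope, abs_div, abs_of_pos hy, div_le_iff₀ hy]
  exact hpd y hy

lemma abs_normalSlope_sub_le {L : ℝ} (hL : 0 ≤ L)
    (hpd : ∀ y : Eu n, 0 < y ln → |pd ψ ln y| ≤ L * y ln)
    (hlip : ∀ y z : Eu n, 0 < y ln → 0 < z ln → |pd ψ ln y - pd ψ ln z| ≤ L * ‖y - z‖)
    {κ R : ℝ} (hκ : κ ≤ 1 / 2) (hR : 0 < R) {y : Eu n} (hy : 0 < y ln)
    (hyR : ‖y - R • EuclideanSpace.single ln (1 : ℝ)‖ ≤ κ * R) :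
    |normalSlope ψ ln y - normalSlope ψ ln (R • EuclideanSpace.single ln (1 : ℝ))|
      ≤ 4 * L * κ := by
  set x := R • EuclideanSpace.single ln (1 : ℝ) with hx
  have hxn : x ln = R := by simp [hx]
  have hxpos : 0 < x ln := hxn ▸ hR
  have h1 : |y ln - R| ≤ κ * R := by
    refine le_trans ?_ hyR
    simpa [hxn] using PiLp.norm_apply_le (y - x) ln
  have h2 : R ≤ 2 * y ln := by
    have := (abs_le.1 h1).1
    nlinarith
  have hκ0 : 0 ≤ κ := nonneg_of_mul_nonneg_left ((norm_nonneg _).trans hyR) hR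
  have h3 : normalSlope ψ ln y - normalSlope ψ ln x
      = ((pd ψ ln y - pd ψ ln x) - normalSlope ψ ln x * (y ln - R)) / y ln := by
    rw [normalSlope, normalSlope, hxn]
    field_simp
    ring
  rw [h3, abs_div, abs_of_pos hy, div_le_iff₀ hy]
  calc _ ≤ |pd ψ ln y - pd ψ ln x| + |normalSlope ψ ln x * (y ln - R)| := abs_sub _ _
    _ ≤ L * (κ * R) + L * (κ * R) := by
      rw [abs_mul]
      gcongr
      · exact (hlip y x hy hxpos).trans (by gcongr)
      · exact abs_normalSlope_le hpd hxpos
    _ = 2 * L * κ * R := by ring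
    _ ≤ 2 * L * κ * (2 * y ln) := by gcongr
    _ = _ := by ring

variable {Dψ : Eu n → (Eu n →L[ℝ] ℝ)} {L : NNReal}

lemma pd_eq_of_hasFDerivWithinAt
    (hD : ∀ x : Eu n, 0 ≤ x ln → HasFDerivWithinAt ψ (Dψ x) {y : Eu n | 0 ≤ y ln} x) {y : Eu n}
    (hy : 0 < y ln) (i : Fin n) : pd ψ i y = Dψ y (EuclideanSpace.single i 1) := by
  have h1 : {y : Eu n | 0 ≤ y ln} ∈ nhds y :=
    Filter.mem_of_superset ((isOpen_halfSpace ln).mem_nhds hy) fun z (hz : 0 < z ln) => hz.le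
  rw [pd, ((hD y hy.le).hasFDerivAt h1).fderiv]

lemma abs_apply_single_sub_le (hL : LipschitzOnWith L Dψ {y : Eu n | 0 ≤ y ln}) {y z : Eu n}
    (hy : 0 ≤ y ln) (hz : 0 ≤ z ln) (i : Fin n) :
    |Dψ y (EuclideanSpace.single i 1) - Dψ z (EuclideanSpace.single i 1)| ≤ L * ‖y - z‖ := by
  have h1 := (Dψ y - Dψ z).le_opNorm (EuclideanSpace.single i 1)
  rw [PiLp.norm_single, norm_one, mul_one, _root_.sub_apply, Real.norm_eq_abs] at h1
  exact h1.trans (hL.norm_sub_le hy hz)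

lemma abs_pd_normal_le
    (hD : ∀ x : Eu n, 0 ≤ x ln → HasFDerivWithinAt ψ (Dψ x) {y : Eu n | 0 ≤ y ln} x)
    (hL : LipschitzOnWith L Dψ {y : Eu n | 0 ≤ y ln})
    (hN : ∀ y : Eu n, y ln = 0 → Dψ y (EuclideanSpace.single ln 1) = 0) {y : Eu n}
    (hy : 0 < y ln) : |pd ψ ln y| ≤ L * y ln := by
  set x : Eu n := y - y ln • EuclideanSpace.single ln (1 : ℝ) with hx
  have hxn : x ln = 0 := by simp [hx]
  have h1 := abs_apply_single_sub_le hL hy.le hxn.ge ln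
  rw [hN x hxn, sub_zero, ← pd_eq_of_hasFDerivWithinAt hD hy] at h1
  simpa [hx, norm_smul, abs_of_pos hy] using h1

open Matrix in
lemma dotProduct_tangentialHessian_le (hψ : ContDiffOn ℝ 2 ψ {y : Eu n | 0 < y ln}) {K₁ : ℝ}
    {y : Eu n} (hy : 0 < y ln) (hK : ‖fderiv ℝ (fderiv ℝ ψ) y‖ ≤ K₁)
    (ξ : {k : Fin n // k ≠ ln} → ℝ) :
    ξ ⬝ᵥ tangentialHessian ψ ln y *ᵥ ξ ≤ K₁ * (ξ ⬝ᵥ ξ) := by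
  rw [dotProduct_tangentialHessian hψ hy, ← norm_sq_extendTangential]
  calc _ ≤ ‖fderiv ℝ (fderiv ℝ ψ) y (extendTangential ξ) (extendTangential ξ)‖ :=
      Real.le_norm_self _
    _ ≤ ‖fderiv ℝ (fderiv ℝ ψ) y‖ * ‖extendTangential ξ‖ * ‖extendTangential ξ‖ :=
      ContinuousLinearMap.le_opNorm₂ _ _ _
    _ ≤ K₁ * ‖extendTangential ξ‖ * ‖extendTangential ξ‖ := by gcongr
    _ = _ := by ring

open Matrix in
lemma le_dotProduct_tangentialHessian {K₂ : ℝ} {y : Eu n}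
    (hK : ∀ ξ : Fin n → ℝ, ξ ln = 0 →
      K₂⁻¹ * (∑ i, ξ i ^ 2) ≤ ∑ i, ∑ j, pd2 ψ i j y * ξ i * ξ j)
    (ξ : {k : Fin n // k ≠ ln} → ℝ) :
    K₂⁻¹ * (ξ ⬝ᵥ ξ) ≤ ξ ⬝ᵥ tangentialHessian ψ ln y *ᵥ ξ := by
  have h1 := hK (extendTangential ξ).ofLp (by simp)
  simp only [Fintype.sum_eq_add_sum_subtype_ne _ ln, extendTangential_apply_normal,
    extendTangential_apply] at h1
  simp only [dotProduct, mulVec, tangentialHessian, of_apply, Finset.mul_sum]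
  convert h1 using 1
  · simp [Finset.mul_sum, sq]
  · simp [mul_comm, mul_left_comm]

end Gradient

theorem stmt8 (n : ℕ) (hn : 2 ≤ n) (ln : Fin n) (hln : (ln : ℕ) = n - 1)
    (b : ℝ) (hb : -1 < b) (K₁ K₂ : ℝ) (hK₁ : 0 < K₁) (hK₂ : 0 < K₂) :
    ∃ α C : ℝ, α ∈ Set.Ioo (0 : ℝ) 1 ∧ 0 < C ∧
      ∀ (ψ : Eu n → ℝ) (Dψ : Eu n → (Eu n →L[ℝ] ℝ)) (L : NNReal),
        -- ψ* is C¹ on the closed half-space with gradient Dψ, which is Lipschitz there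
        (∀ x : Eu n, 0 ≤ x ln →
          HasFDerivWithinAt ψ (Dψ x) {y : Eu n | 0 ≤ y ln} x) →
        LipschitzOnWith L Dψ {y : Eu n | 0 ≤ y ln} →
        -- ψ* is C² in the open half-space
        ContDiffOn ℝ 2 ψ {y : Eu n | 0 < y ln} →
        -- equation ψ*_{nn} + b ψ*_n / y_n + det D²_{y'} ψ* = 0
        (∀ y : Eu n, 0 < y ln →
          pd2 ψ ln ln y + b * pd ψ ln y / y ln +
            (Matrix.of fun (i j : {k : Fin n // k ≠ ln}) => pd2 ψ i.1 j.1 y).det = 0) →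
        -- Neumann boundary condition
        (∀ y : Eu n, y ln = 0 → Dψ y (EuclideanSpace.single ln 1) = 0) →
        -- D²_{y'}ψ* is positive definite
        (∀ y : Eu n, 0 < y ln →
          (Matrix.of fun (i j : {k : Fin n // k ≠ ln}) => pd2 ψ i.1 j.1 y).PosDef) →
        -- ‖D²ψ*‖ ≤ K₁
        (∀ y : Eu n, 0 < y ln → ‖fderiv ℝ (fderiv ℝ ψ) y‖ ≤ K₁) →
        -- ‖(D²_{y'}ψ*)⁻¹‖ ≤ K₂, i.e. ξᵀ D²_{y'}ψ* ξ ≥ K₂⁻¹|ξ|² in tangential directions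
        (∀ y : Eu n, 0 < y ln → ∀ ξ : Fin n → ℝ, ξ ln = 0 →
          K₂⁻¹ * (∑ i, ξ i ^ 2) ≤ ∑ i, ∑ j, pd2 ψ i j y * ξ i * ξ j) →
        -- Hölder continuity of ψ*_{y_n}/y_n on ℝ^{n-1} × (0,1]
        ∀ y z : Eu n, 0 < y ln → y ln ≤ 1 → 0 < z ln → z ln ≤ 1 →
          |pd ψ ln y / y ln - pd ψ ln z / z ln| ≤ C * ‖y - z‖ ^ α := by
  refine ⟨1 / 2, 1, by norm_num, one_pos, ?_⟩
  intro ψ Dψ L hD hL hψ heq hN hpos hK₁' hK₂' y z hy _ hz _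
  have h : IsHalfSpaceSolution ψ ln b K₁ K₂ :=
    ⟨hψ, heq, hpos, fun y hy => dotProduct_tangentialHessian_le hψ hy (hK₁' y hy),
      fun y hy => le_dotProduct_tangentialHessian (hK₂' y hy)⟩
  have hpd : ∀ y : Eu n, 0 < y ln → |pd ψ ln y| ≤ L * y ln :=
    fun y hy => abs_pd_normal_le hD hL hN hy
  have hlip : ∀ y z : Eu n, 0 < y ln → 0 < z ln → |pd ψ ln y - pd ψ ln z| ≤ L * ‖y - z‖ := by
    intro y z hy hz
    rw [pd_eq_of_hasFDerivWithinAt hD hy, pd_eq_of_hasFDerivWithinAt hD hz]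
    exact abs_apply_single_sub_le hL hy.le hz.le ln
  have hw : normalSlope ψ ln y = normalSlope ψ ln z :=
    h.normalSlope_eq hb hK₁ hK₂ L.coe_nonneg (fun y hy => abs_normalSlope_le hpd hy)
      (fun κ R hκ hR y hy hyR => abs_normalSlope_sub_le L.coe_nonneg hpd hlip hκ hR hy hyR) hy hz
  rw [normalSlope, normalSlope] at hw
  rw [hw, sub_self, abs_zero]
  positivity
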